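/- Suppose 𝒜 satisfies RIP on rank-2r matrices with parameter δ_{2r} and on rank-4r matrices with parameter δ_{4r}, let (U*, V*) be a balanced factorization of a rank-r matrix X* with W* = [U*; V*], and let b ∈ ℝ^p. If W = [U; V] satisfies the first-order optimality condition for f+g, and Q is a matrix with orthonormal columns spanning the column space of W, then (1/4)·‖(WWᵀ − W*W*ᵀ)·QQᵀ‖_F ≤ δ_{4r}·‖WWᵀ − W*W*ᵀ‖_F + √((1+δ_{2r})/2)·‖𝒜(U*V*ᵀ) − b‖₂. -/

import Mathlib

open Matrix BigOperators

noncomputable section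

/-- Trace inner product `⟨X, Y⟩ = trace (Xᵀ * Y) = ∑ᵢⱼ Xᵢⱼ Yᵢⱼ`. -/
def ip {α β : Type*} [Fintype α] [Fintype β] (X Y : Matrix α β ℝ) : ℝ :=
  ∑ i, ∑ j, X i j * Y i j

/-- Frobenius norm. -/
def fnorm {α β : Type*} [Fintype α] [Fintype β] (X : Matrix α β ℝ) : ℝ :=
  Real.sqrt (∑ i, ∑ j, X i j ^ 2)

/-- Euclidean (ℓ₂) norm of a vector. -/
def vnorm {α : Type*} [Fintype α] (x : α → ℝ) : ℝ :=
  Real.sqrt (∑ i, x i ^ 2)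

/-- The linear operator `𝒜(X)ᵢ = ⟨Aᵢ, X⟩` satisfies the restricted isometry property on
rank-`k` matrices with parameter `δ`. -/
def RIP {m n p : ℕ} (A : Fin p → Matrix (Fin m) (Fin n) ℝ) (k : ℕ) (δ : ℝ) : Prop :=
  ∀ X : Matrix (Fin m) (Fin n) ℝ, X.rank ≤ k →
    (1 - δ) * fnorm X ^ 2 ≤ ∑ i, ip (A i) X ^ 2 ∧
      ∑ i, ip (A i) X ^ 2 ≤ (1 + δ) * fnorm X ^ 2

/-- Vertical stacking `[U; V]`. -/
def stack {m n r : ℕ} (U : Matrix (Fin m) (Fin r) ℝ) (V : Matrix (Fin n) (Fin r) ℝ) :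
    Matrix (Fin m ⊕ Fin n) (Fin r) ℝ :=
  Matrix.fromRows U V

/-- For `Z = [Z_U; Z_V]`, `tilde Z = [Z_U; -Z_V]` (negate the bottom block). -/
def tilde {m n r : ℕ} (Z : Matrix (Fin m ⊕ Fin n) (Fin r) ℝ) :
    Matrix (Fin m ⊕ Fin n) (Fin r) ℝ :=
  Matrix.of (Sum.elim (fun i j => Z (Sum.inl i) j) (fun i j => -Z (Sum.inr i) j))

/-- `Bᵢ = (1/2) · [[0, Aᵢ], [Aᵢᵀ, 0]]`. -/
def Bmat {m n p : ℕ} (A : Fin p → Matrix (Fin m) (Fin n) ℝ) (i : Fin p) :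
    Matrix (Fin m ⊕ Fin n) (Fin m ⊕ Fin n) ℝ :=
  (1 / 2 : ℝ) • Matrix.fromBlocks 0 (A i) (A i)ᵀ 0

/-- `(U, V)` is a balanced ("equally-footed") factorization of `X`: for some SVD
`X = A · diagonal S · Bᵀ` (with `A, B` having orthonormal columns and `S` the nonnegative
singular values) and some orthonormal `R`, `U = A · S^{1/2} · R` and `V = B · S^{1/2} · R`. -/
def IsBalanced {m n r : ℕ} (X : Matrix (Fin m) (Fin n) ℝ)
    (U : Matrix (Fin m) (Fin r) ℝ) (V : Matrix (Fin n) (Fin r) ℝ) : Prop :=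
  ∃ (A : Matrix (Fin m) (Fin r) ℝ) (B : Matrix (Fin n) (Fin r) ℝ)
    (S : Fin r → ℝ) (R : Matrix (Fin r) (Fin r) ℝ),
      Aᵀ * A = 1 ∧ Bᵀ * B = 1 ∧ (∀ i, 0 ≤ S i) ∧ Rᵀ * R = 1 ∧ R * Rᵀ = 1 ∧
      X = A * Matrix.diagonal S * Bᵀ ∧
      U = A * Matrix.diagonal (fun i => Real.sqrt (S i)) * R ∧
      V = B * Matrix.diagonal (fun i => Real.sqrt (S i)) * R

/-- `Dist(U, V; X) = min ‖[U; V] − [U*; V*]‖_F` over balanced factorizations `(U*, V*)` of `X`. -/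
def distW {m n r : ℕ} (U : Matrix (Fin m) (Fin r) ℝ) (V : Matrix (Fin n) (Fin r) ℝ)
    (X : Matrix (Fin m) (Fin n) ℝ) : ℝ :=
  sInf {d : ℝ | ∃ (U' : Matrix (Fin m) (Fin r) ℝ) (V' : Matrix (Fin n) (Fin r) ℝ),
    IsBalanced X U' V' ∧ d = fnorm (stack U V - stack U' V')}

/-- First-order optimality condition for `f + g` at `W = [U; V]`:
`∑ᵢ (⟨Bᵢ, WWᵀ⟩ − bᵢ) Bᵢ W + (1/4) W̃ W̃ᵀ W = 0`. -/
def FirstOrderOpt {m n r p : ℕ} (A : Fin p → Matrix (Fin m) (Fin n) ℝ) (b : Fin p → ℝ)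
    (U : Matrix (Fin m) (Fin r) ℝ) (V : Matrix (Fin n) (Fin r) ℝ) : Prop :=
  (∑ i, (ip (Bmat A i) (stack U V * (stack U V)ᵀ) - b i) • (Bmat A i * stack U V))
    + (1 / 4 : ℝ) • (stack U (-V) * (stack U (-V))ᵀ * stack U V) = 0

/-- The Hessian quadratic form of `f + g` at `W = [U; V]` in direction `Z`. -/
def hessForm {m n r p : ℕ} (A : Fin p → Matrix (Fin m) (Fin n) ℝ) (b : Fin p → ℝ)
    (U : Matrix (Fin m) (Fin r) ℝ) (V : Matrix (Fin n) (Fin r) ℝ)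
    (Z : Matrix (Fin m ⊕ Fin n) (Fin r) ℝ) : ℝ :=
  (∑ i, ip (Bmat A i) (Z * (stack U V)ᵀ + stack U V * Zᵀ) * ip (Bmat A i) (Z * (stack U V)ᵀ))
    + (∑ i, (ip (Bmat A i) (stack U V * (stack U V)ᵀ) - b i) * ip (Bmat A i) (Z * Zᵀ))
    + (1 / 4 : ℝ) * ip (tilde Z * (stack U (-V))ᵀ + stack U (-V) * (tilde Z)ᵀ)
        (Z * (stack U V)ᵀ)
    + (1 / 4 : ℝ) * ip (stack U (-V) * (stack U (-V))ᵀ) (Z * Zᵀ)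

/-- Second-order optimality condition for `f + g` at `W = [U; V]`: the Hessian quadratic
form is nonnegative in every direction `Z = [Z_U; Z_V]`. -/
def SecondOrderOpt {m n r p : ℕ} (A : Fin p → Matrix (Fin m) (Fin n) ℝ) (b : Fin p → ℝ)
    (U : Matrix (Fin m) (Fin r) ℝ) (V : Matrix (Fin n) (Fin r) ℝ) : Prop :=
  ∀ Z : Matrix (Fin m ⊕ Fin n) (Fin r) ℝ, 0 ≤ hessForm A b U V Z

section FrobeniusInnerProduct

variable {α β γ : Type*} [Fintype α] [Fintype β] [Fintype γ]

theorem ip_eq_trace (X Y : Matrix α β ℝ) : ip X Y = trace (Xᵀ * Y) := by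
  simp only [ip, trace, diag_apply, mul_apply, transpose_apply]
  exact Finset.sum_comm

theorem fnorm_sq (X : Matrix α β ℝ) : fnorm X ^ 2 = ip X X := by
  rw [fnorm, Real.sq_sqrt (by positivity)]
  simp only [ip, pow_two]

theorem fnorm_nonneg (X : Matrix α β ℝ) : 0 ≤ fnorm X := Real.sqrt_nonneg _

theorem ip_self_nonneg (X : Matrix α β ℝ) : 0 ≤ ip X X := by
  rw [← fnorm_sq]; positivity

theorem eq_zero_of_fnorm_eq_zero {X : Matrix α β ℝ} (h : fnorm X = 0) : X = 0 := by
  rw [fnorm, Real.sqrt_eq_zero (by positivity),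
    Finset.sum_eq_zero_iff_of_nonneg fun i _ => by positivity] at h
  ext i j
  have hi := h i (Finset.mem_univ i)
  rw [Finset.sum_eq_zero_iff_of_nonneg fun j _ => by positivity] at hi
  simpa using hi j (Finset.mem_univ j)

theorem ip_comm (X Y : Matrix α β ℝ) : ip X Y = ip Y X := by
  simp only [ip, mul_comm]

theorem ip_add_right (X Y Z : Matrix α β ℝ) : ip X (Y + Z) = ip X Y + ip X Z := by
  simp [ip_eq_trace, Matrix.mul_add]

theorem ip_sub_right (X Y Z : Matrix α β ℝ) : ip X (Y - Z) = ip X Y - ip X Z := by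
  simp [ip_eq_trace, Matrix.mul_sub]

theorem ip_smul_right (c : ℝ) (X Y : Matrix α β ℝ) : ip X (c • Y) = c * ip X Y := by
  simp [ip_eq_trace]

theorem ip_neg_left (X Y : Matrix α β ℝ) : ip (-X) Y = -ip X Y := by
  simp [ip_eq_trace]

theorem ip_sub_left (X Y Z : Matrix α β ℝ) : ip (X - Y) Z = ip X Z - ip Y Z := by
  simp [ip_eq_trace, Matrix.sub_mul]

theorem ip_add_left (X Y Z : Matrix α β ℝ) : ip (X + Y) Z = ip X Z + ip Y Z := by
  simp [ip_eq_trace, Matrix.add_mul]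

theorem ip_smul_left (c : ℝ) (X Y : Matrix α β ℝ) : ip (c • X) Y = c * ip X Y := by
  simp [ip_eq_trace]

theorem ip_sum_left {ι : Type*} (s : Finset ι) (X : ι → Matrix α β ℝ) (Y : Matrix α β ℝ) :
    ip (∑ i ∈ s, X i) Y = ∑ i ∈ s, ip (X i) Y := by
  simp [ip_eq_trace, transpose_sum, Matrix.sum_mul, trace_sum]

theorem ip_transpose (X Y : Matrix α β ℝ) : ip Xᵀ Yᵀ = ip X Y := by
  simp only [ip, transpose_apply]
  exact Finset.sum_comm

theorem ip_mul_right (X : Matrix α β ℝ) (Y : Matrix α γ ℝ) (P : Matrix γ β ℝ) :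
    ip X (Y * P) = ip (X * Pᵀ) Y := by
  rw [ip_eq_trace, ip_eq_trace, transpose_mul, transpose_transpose, ← Matrix.mul_assoc,
    trace_mul_comm, Matrix.mul_assoc]

theorem ip_fromBlocks {κ : Type*} [Fintype κ] (A A' : Matrix α β ℝ) (B B' : Matrix α γ ℝ)
    (C C' : Matrix κ β ℝ) (D D' : Matrix κ γ ℝ) :
    ip (fromBlocks A B C D) (fromBlocks A' B' C' D') = ip A A' + ip B B' + (ip C C' + ip D D') := by
  simp only [ip, Fintype.sum_sum_type, fromBlocks_apply₁₁, fromBlocks_apply₁₂, fromBlocks_apply₂₁,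
    fromBlocks_apply₂₂, Finset.sum_add_distrib]
  ring

end FrobeniusInnerProduct

theorem exists_eq_mul_of_range_le {α β γ : Type*} [Fintype β] [Fintype γ] [DecidableEq β]
    {X : Matrix α β ℝ} {Y : Matrix α γ ℝ}
    (h : LinearMap.range X.mulVecLin ≤ LinearMap.range Y.mulVecLin) :
    ∃ N : Matrix γ β ℝ, X = Y * N := by
  have key : ∀ j : β, ∃ v : γ → ℝ, Y *ᵥ v = X.col j := fun j => by
    obtain ⟨v, hv⟩ := h ⟨Pi.single j 1, rfl⟩
    exact ⟨v, by simpa using hv⟩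
  choose N hN using key
  refine ⟨(of N)ᵀ, ?_⟩
  ext i j
  simpa [mulVec, dotProduct, mul_apply] using (congrFun (hN j) i).symm

theorem rank_mul_le_width {m n r : ℕ} (L : Matrix (Fin m) (Fin r) ℝ)
    (M : Matrix (Fin r) (Fin n) ℝ) : (L * M).rank ≤ r :=
  (rank_mul_le_left L M).trans (rank_le_width L)

theorem Matrix.rank_add_le {m n : ℕ} (X Y : Matrix (Fin m) (Fin n) ℝ) :
    (X + Y).rank ≤ X.rank + Y.rank := by
  rw [rank, rank, rank, mulVecLin_add]
  exact (Submodule.finrank_mono (LinearMap.range_add_le _ _)).trans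
    (Submodule.finrank_add_le_finrank_add_finrank _ _)

theorem rank_add_smul_le {m n : ℕ} (X Y : Matrix (Fin m) (Fin n) ℝ) (t : ℝ) :
    (X + t • Y).rank ≤ X.rank + Y.rank := by
  refine (rank_add_le _ _).trans (Nat.add_le_add_left ?_ _)
  have : t • Y = Y * t • (1 : Matrix (Fin n) (Fin n) ℝ) := by simp
  rw [this]
  exact rank_mul_le_left _ _

namespace RIP

variable {m n p k : ℕ} {A : Fin p → Matrix (Fin m) (Fin n) ℝ} {δ : ℝ}

theorem nonneg (h : RIP A k δ) {X : Matrix (Fin m) (Fin n) ℝ} (hX : X.rank ≤ k) (hX0 : X ≠ 0) :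
    0 ≤ δ := by
  have hpos : 0 < fnorm X := (fnorm_nonneg X).lt_of_ne' fun h => hX0 (eq_zero_of_fnorm_eq_zero h)
  have hle := (h X hX).1.trans (h X hX).2
  by_contra! hδ
  nlinarith [pow_pos hpos 2]

/-- Polarized form of the restricted isometry property. -/
theorem abs_sum_mul_sub_ip_le (h : RIP A k δ) (hδ : 0 ≤ δ) {X Y : Matrix (Fin m) (Fin n) ℝ}
    (hXY : X.rank + Y.rank ≤ k) :
    |∑ i, ip (A i) X * ip (A i) Y - ip X Y| ≤ δ * (fnorm X * fnorm Y) := by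
  have hquad : ∀ t : ℝ, 0 ≤ δ * fnorm Y ^ 2 * (t * t) +
      2 * (∑ i, ip (A i) X * ip (A i) Y - ip X Y) * t + δ * fnorm X ^ 2 := fun t => by
    have h₁ := (h (X + t • Y) ((rank_add_smul_le X Y t).trans hXY)).1
    have h₂ := (h (X + (-t) • Y) ((rank_add_smul_le X Y (-t)).trans hXY)).2
    have hA : ∀ s : ℝ, ∑ i, ip (A i) (X + s • Y) ^ 2 = ∑ i, ip (A i) X ^ 2 +
        2 * s * ∑ i, ip (A i) X * ip (A i) Y + s ^ 2 * ∑ i, ip (A i) Y ^ 2 := fun s => by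
      simp only [Finset.mul_sum, ← Finset.sum_add_distrib, ip_add_right, ip_smul_right]
      exact Finset.sum_congr rfl fun i _ => by ring
    have hF : ∀ s : ℝ, fnorm (X + s • Y) ^ 2 =
        fnorm X ^ 2 + 2 * s * ip X Y + s ^ 2 * fnorm Y ^ 2 := fun s => by
      simp only [fnorm_sq, ip_add_right, ip_smul_right, ip_add_left, ip_smul_left, ip_comm Y X]
      ring
    rw [hA, hF] at h₁ h₂
    linarith
  have hdisc := discrim_le_zero hquad
  rw [discrim] at hdisc
  have hnn := mul_nonneg hδ (mul_nonneg (fnorm_nonneg X) (fnorm_nonneg Y))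
  exact abs_le_of_sq_le_sq (by linarith) hnn

theorem abs_sum_mul_le (h : RIP A k δ) (e : Fin p → ℝ) {Y : Matrix (Fin m) (Fin n) ℝ}
    (hY : Y.rank ≤ k) :
    |∑ i, e i * ip (A i) Y| ≤ vnorm e * (√(1 + δ) * fnorm Y) := by
  refine (Real.abs_le_sqrt (Finset.sum_mul_sq_le_sq_mul_sq _ _ _)).trans ?_
  rw [Real.sqrt_mul (by positivity), vnorm]
  refine mul_le_mul_of_nonneg_left ?_ (Real.sqrt_nonneg _)
  refine (Real.sqrt_le_sqrt (h Y hY).2).trans_eq ?_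
  rw [Real.sqrt_mul' _ (sq_nonneg _), Real.sqrt_sq (fnorm_nonneg Y)]

end RIP

section Stack

variable {m n r p : ℕ}

theorem stack_mul_transpose (U : Matrix (Fin m) (Fin r) ℝ) (V : Matrix (Fin n) (Fin r) ℝ) :
    stack U V * (stack U V)ᵀ = fromBlocks (U * Uᵀ) (U * Vᵀ) (V * Uᵀ) (V * Vᵀ) := by
  rw [stack, transpose_fromRows, fromRows_mul_fromCols]

theorem stack_neg_transpose_mul_stack {U : Matrix (Fin m) (Fin r) ℝ}
    {V : Matrix (Fin n) (Fin r) ℝ} (h : Uᵀ * U = Vᵀ * V) :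
    (stack U (-V))ᵀ * stack U V = 0 := by
  rw [stack, stack, transpose_fromRows, fromCols_mul_fromRows, h, transpose_neg, Matrix.neg_mul,
    add_neg_cancel]

theorem IsBalanced.transpose_mul_self_eq {X : Matrix (Fin m) (Fin n) ℝ}
    {U : Matrix (Fin m) (Fin r) ℝ} {V : Matrix (Fin n) (Fin r) ℝ} (h : IsBalanced X U V) :
    Uᵀ * U = Vᵀ * V := by
  obtain ⟨A, B, S, R, hA, hB, -, -, -, -, rfl, rfl⟩ := h
  simp only [transpose_mul, Matrix.mul_assoc]
  rw [← Matrix.mul_assoc Aᵀ, ← Matrix.mul_assoc Bᵀ, hA, hB]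

theorem ip_Bmat_fromBlocks (A : Fin p → Matrix (Fin m) (Fin n) ℝ) (i : Fin p)
    (Z₁₁ : Matrix (Fin m) (Fin m) ℝ) (Z₁₂ : Matrix (Fin m) (Fin n) ℝ)
    (Z₂₁ : Matrix (Fin n) (Fin m) ℝ) (Z₂₂ : Matrix (Fin n) (Fin n) ℝ) :
    ip (Bmat A i) (fromBlocks Z₁₁ Z₁₂ Z₂₁ Z₂₂) = 1 / 2 * ip (A i) (Z₁₂ + Z₂₁ᵀ) := by
  rw [Bmat, ip_smul_left, ip_fromBlocks, ip_add_right, ← ip_transpose (A i) Z₂₁ᵀ,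
    transpose_transpose]
  simp [ip]

theorem ip_Bmat_stack (A : Fin p → Matrix (Fin m) (Fin n) ℝ) (i : Fin p)
    (U : Matrix (Fin m) (Fin r) ℝ) (V : Matrix (Fin n) (Fin r) ℝ) :
    ip (Bmat A i) (stack U V * (stack U V)ᵀ) = ip (A i) (U * Vᵀ) := by
  rw [stack_mul_transpose, ip_Bmat_fromBlocks, transpose_mul, transpose_transpose, ip_add_right]
  ring

theorem fnorm_add_transpose_le (Z₁₁ : Matrix (Fin m) (Fin m) ℝ) (Z₁₂ : Matrix (Fin m) (Fin n) ℝ)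
    (Z₂₁ : Matrix (Fin n) (Fin m) ℝ) (Z₂₂ : Matrix (Fin n) (Fin n) ℝ) :
    fnorm (Z₁₂ + Z₂₁ᵀ) ≤ √2 * fnorm (fromBlocks Z₁₁ Z₁₂ Z₂₁ Z₂₂) := by
  refine abs_le_of_sq_le_sq' ?_ (mul_nonneg (Real.sqrt_nonneg _) (fnorm_nonneg _)) |>.2
  rw [mul_pow, Real.sq_sqrt zero_le_two, fnorm_sq, fnorm_sq, ip_fromBlocks]
  have h := ip_self_nonneg (Z₁₂ - Z₂₁ᵀ)
  have hT := ip_transpose Z₂₁ Z₂₁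
  simp only [ip_add_left, ip_add_right, ip_sub_left, ip_sub_right] at h ⊢
  linarith [ip_self_nonneg Z₁₁, ip_self_nonneg Z₂₂]

theorem sqrt_two_mul_fnorm_le (D₁₁ : Matrix (Fin m) (Fin m) ℝ) (D₁₂ : Matrix (Fin m) (Fin n) ℝ)
    (D₂₂ : Matrix (Fin n) (Fin n) ℝ) :
    √2 * fnorm D₁₂ ≤ fnorm (fromBlocks D₁₁ D₁₂ D₁₂ᵀ D₂₂) := by
  refine abs_le_of_sq_le_sq' ?_ (fnorm_nonneg _) |>.2
  rw [mul_pow, Real.sq_sqrt zero_le_two, fnorm_sq, fnorm_sq, ip_fromBlocks, ip_transpose]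
  linarith [ip_self_nonneg D₁₁, ip_self_nonneg D₂₂]

theorem stack_mul_transpose_sub (U Us : Matrix (Fin m) (Fin r) ℝ)
    (V Vs : Matrix (Fin n) (Fin r) ℝ) :
    stack U V * (stack U V)ᵀ - stack Us Vs * (stack Us Vs)ᵀ =
      fromBlocks (U * Uᵀ - Us * Usᵀ) (U * Vᵀ - Us * Vsᵀ) (U * Vᵀ - Us * Vsᵀ)ᵀ
        (V * Vᵀ - Vs * Vsᵀ) := by
  rw [stack_mul_transpose, stack_mul_transpose, sub_eq_add_neg, fromBlocks_neg, fromBlocks_add]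
  simp [sub_eq_add_neg]

/-- The off-diagonal part of `WWᵀ - W*W*ᵀ` combines with the regularizer gradient `W̃W̃ᵀ`. -/
theorem ip_offDiag_add_ip_stack_neg (U Us : Matrix (Fin m) (Fin r) ℝ)
    (V Vs : Matrix (Fin n) (Fin r) ℝ) (Z₁₁ : Matrix (Fin m) (Fin m) ℝ)
    (Z₁₂ : Matrix (Fin m) (Fin n) ℝ) (Z₂₁ : Matrix (Fin n) (Fin m) ℝ)
    (Z₂₂ : Matrix (Fin n) (Fin n) ℝ) :
    2 * ip (U * Vᵀ - Us * Vsᵀ) (Z₁₂ + Z₂₁ᵀ) +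
        ip (stack U (-V) * (stack U (-V))ᵀ) (fromBlocks Z₁₁ Z₁₂ Z₂₁ Z₂₂) =
      ip (stack U V * (stack U V)ᵀ - stack Us Vs * (stack Us Vs)ᵀ) (fromBlocks Z₁₁ Z₁₂ Z₂₁ Z₂₂) +
        ip (stack Us (-Vs) * (stack Us (-Vs))ᵀ) (fromBlocks Z₁₁ Z₁₂ Z₂₁ Z₂₂) := by
  have hT : ∀ (M : Matrix (Fin m) (Fin r) ℝ) (N : Matrix (Fin n) (Fin r) ℝ),
      ip (M * Nᵀ) Z₂₁ᵀ = ip (N * Mᵀ) Z₂₁ := fun M N => by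
    rw [← ip_transpose, transpose_mul, transpose_transpose, transpose_transpose]
  simp only [stack_mul_transpose, ip_sub_left, ip_neg_left, ip_add_right, ip_fromBlocks, hT,
    transpose_neg, Matrix.neg_mul, Matrix.mul_neg, neg_neg]
  ring

end Stack

/-- Lemma 6 / variant of Lemma 4.2 of Bhojanapalli et al.: if `W = [U; V]`
satisfies the first-order optimality condition and `Q` has orthonormal columns spanning
the column space of `W`, then `(1/4)‖(WWᵀ − W*W*ᵀ)QQᵀ‖_F ≤ δ₄ᵣ ‖WWᵀ − W*W*ᵀ‖_F +
√((1+δ₂ᵣ)/2) ‖𝒜(U*V*ᵀ) − b‖₂`. -/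
theorem first_order_projection_bound {m n r p k : ℕ}
    (A : Fin p → Matrix (Fin m) (Fin n) ℝ) (δ2r δ4r : ℝ)
    (hRIP2 : RIP A (2 * r) δ2r) (hRIP4 : RIP A (4 * r) δ4r)
    (X : Matrix (Fin m) (Fin n) ℝ) (hrank : X.rank = r)
    (Us : Matrix (Fin m) (Fin r) ℝ) (Vs : Matrix (Fin n) (Fin r) ℝ)
    (hbal : IsBalanced X Us Vs)
    (b : Fin p → ℝ)
    (U : Matrix (Fin m) (Fin r) ℝ) (V : Matrix (Fin n) (Fin r) ℝ)
    (h1 : FirstOrderOpt A b U V)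
    (Q : Matrix (Fin m ⊕ Fin n) (Fin k) ℝ) (hQ : Qᵀ * Q = 1)
    (hQspan : LinearMap.range Q.mulVecLin = LinearMap.range (stack U V).mulVecLin) :
    (1 / 4 : ℝ) *
        fnorm ((stack U V * (stack U V)ᵀ - stack Us Vs * (stack Us Vs)ᵀ) * (Q * Qᵀ))
      ≤ δ4r * fnorm (stack U V * (stack U V)ᵀ - stack Us Vs * (stack Us Vs)ᵀ)
        + Real.sqrt ((1 + δ2r) / 2) * vnorm (fun i => ip (A i) (Us * Vsᵀ) - b i) := by
  set W := stack U V with hW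
  set Ws := stack Us Vs with hWs
  set D := W * Wᵀ - Ws * Wsᵀ with hD
  set Z := D * (Q * Qᵀ) with hZ
  set e : Fin p → ℝ := fun i => ip (A i) (Us * Vsᵀ) - b i with he
  obtain ⟨N, hN⟩ := exists_eq_mul_of_range_le hQspan.le
  obtain ⟨N', hN'⟩ := exists_eq_mul_of_range_le hQspan.ge
  have hPT : (Q * Qᵀ)ᵀ = Q * Qᵀ := by simp
  have hPW : Q * Qᵀ * W = W := by
    rw [hN', Matrix.mul_assoc, ← Matrix.mul_assoc Qᵀ, hQ, Matrix.one_mul]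
  have hQQ : Q * Qᵀ = W * (N * Qᵀ) := by rw [← Matrix.mul_assoc, ← hN]
  have hPP : Q * Qᵀ * (Q * Qᵀ) = Q * Qᵀ := by
    rw [Matrix.mul_assoc, ← Matrix.mul_assoc Qᵀ, hQ, Matrix.one_mul]
  -- `Z` factors through `Fin r`, hence its blocks have rank at most `r`
  obtain ⟨Z₁₁, Z₁₂, Z₂₁, Z₂₂, hZb, hr₁₂, hr₂₁⟩ : ∃ Z₁₁ Z₁₂ Z₂₁ Z₂₂,
      Z = fromBlocks Z₁₁ Z₁₂ Z₂₁ Z₂₂ ∧ Z₁₂.rank ≤ r ∧ Z₂₁.rank ≤ r := by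
    refine ⟨(D * W).toRows₁ * (N * Qᵀ).toCols₁, (D * W).toRows₁ * (N * Qᵀ).toCols₂,
      (D * W).toRows₂ * (N * Qᵀ).toCols₁, (D * W).toRows₂ * (N * Qᵀ).toCols₂, ?_,
      rank_mul_le_width _ _, rank_mul_le_width _ _⟩
    rw [← fromRows_mul_fromCols, fromRows_toRows, fromCols_toCols, Matrix.mul_assoc, ← hQQ]
  have hYrank : (Z₁₂ + Z₂₁ᵀ).rank ≤ 2 * r := by
    have := rank_add_le Z₁₂ Z₂₁ᵀ
    rw [rank_transpose] at this
    lia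
  have hErank : (U * Vᵀ - Us * Vsᵀ).rank ≤ 2 * r := by
    have := rank_add_le (U * Vᵀ) (-Us * Vsᵀ)
    rw [Matrix.neg_mul, ← sub_eq_add_neg, ← Matrix.neg_mul] at this
    have h₁ := rank_mul_le_width U Vᵀ
    have h₂ := rank_mul_le_width (-Us) Vsᵀ
    lia
  have hDb := stack_mul_transpose_sub U Us V Vs
  rw [← hW, ← hWs, ← hD] at hDb
  have hd0 := fnorm_nonneg D
  have hz0 := fnorm_nonneg Z
  have hv0 : 0 ≤ vnorm e := Real.sqrt_nonneg _
  -- sign of the RIP constant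
  have hδD : 0 ≤ δ4r * fnorm D ∧ (0 < fnorm D → 0 ≤ δ4r) := by
    rcases Nat.eq_zero_or_pos r with rfl | hr
    · have hD0 : D = 0 := by
        ext i j
        simp [hD]
      have : fnorm D = 0 := by simp [hD0, fnorm]
      simp [this]
    · have hX0 : X ≠ 0 := by
        rintro rfl
        rw [rank_zero] at hrank
        lia
      have := hRIP4.nonneg (X := X) (by lia) hX0
      exact ⟨mul_nonneg this hd0, fun _ => this⟩
  rcases hz0.eq_or_lt' with hz | hz
  · rw [hz, mul_zero]
    exact add_nonneg hδD.1 (mul_nonneg (Real.sqrt_nonneg _) hv0)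
  have hdpos : 0 < fnorm D := hd0.lt_of_ne' fun h => by
    have : Z = 0 := by rw [hZ, eq_zero_of_fnorm_eq_zero h, Matrix.zero_mul]
    simp [this, fnorm] at hz
  have hδ := hδD.2 hdpos
  have hgrad : ∑ i, (ip (A i) (U * Vᵀ) - b i) * (1 / 2 * ip (A i) (Z₁₂ + Z₂₁ᵀ)) +
      1 / 4 * ip (stack U (-V) * (stack U (-V))ᵀ) Z = 0 := by
    have hG : (∑ i, (ip (A i) (U * Vᵀ) - b i) • Bmat A i +
        (1 / 4 : ℝ) • (stack U (-V) * (stack U (-V))ᵀ)) * W = 0 := by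
      simp only [FirstOrderOpt, ip_Bmat_stack] at h1
      simpa only [Matrix.add_mul, Matrix.sum_mul, smul_mul] using h1
    have h0 := ip_mul_right (∑ i, (ip (A i) (U * Vᵀ) - b i) • Bmat A i +
        (1 / 4 : ℝ) • (stack U (-V) * (stack U (-V))ᵀ)) D (Q * Qᵀ)
    rw [hPT, ← hZ, hQQ, ← Matrix.mul_assoc _ W, hG, Matrix.zero_mul, ip_add_left,
      ip_sum_left, ip_smul_left] at h0
    simp only [ip_smul_left] at h0
    rw [show ip (0 : Matrix (Fin m ⊕ Fin n) (Fin m ⊕ Fin n) ℝ) D = 0 by simp [ip]] at h0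
    rw [← h0]
    simp only [hZb, ip_Bmat_fromBlocks]
  have hsplit : ∑ i, (ip (A i) (U * Vᵀ) - b i) * (1 / 2 * ip (A i) (Z₁₂ + Z₂₁ᵀ)) =
      1 / 2 * ∑ i, ip (A i) (U * Vᵀ - Us * Vsᵀ) * ip (A i) (Z₁₂ + Z₂₁ᵀ) +
        1 / 2 * ∑ i, e i * ip (A i) (Z₁₂ + Z₂₁ᵀ) := by
    rw [Finset.mul_sum, Finset.mul_sum, ← Finset.sum_add_distrib]
    refine Finset.sum_congr rfl fun i _ => ?_
    rw [ip_sub_right, he]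
    ring
  have hcomb := ip_offDiag_add_ip_stack_neg U Us V Vs Z₁₁ Z₁₂ Z₂₁ Z₂₂
  rw [← hW, ← hWs, ← hD, ← hZb] at hcomb
  have hDZ : ip D Z = fnorm Z ^ 2 := by
    rw [fnorm_sq]
    have h := ip_mul_right Z D (Q * Qᵀ)
    rwa [hPT, hZ, Matrix.mul_assoc D, hPP, ← hZ, ip_comm Z D, eq_comm] at h
  have hreg : 0 ≤ ip (stack Us (-Vs) * (stack Us (-Vs))ᵀ) Z := by
    have horth : (stack Us (-Vs))ᵀ * Ws = 0 :=
      stack_neg_transpose_mul_stack hbal.transpose_mul_self_eq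
    have hZW : (stack Us (-Vs))ᵀ * Z = (stack Us (-Vs))ᵀ * W * Wᵀ := by
      have hWP : Wᵀ * (Q * Qᵀ) = Wᵀ := by
        simpa only [transpose_mul, transpose_transpose] using congrArg transpose hPW
      rw [hZ, hD, Matrix.sub_mul, Matrix.mul_sub, Matrix.mul_assoc W, hWP, Matrix.mul_assoc Ws,
        ← Matrix.mul_assoc _ W, ← Matrix.mul_assoc _ Ws, horth, Matrix.zero_mul, sub_zero]
    have : ip (stack Us (-Vs) * (stack Us (-Vs))ᵀ) Z =
        ip ((stack Us (-Vs))ᵀ * W) ((stack Us (-Vs))ᵀ * W) := by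
      rw [ip_eq_trace, ip_eq_trace, transpose_mul, transpose_transpose, Matrix.mul_assoc, hZW,
        ← Matrix.mul_assoc, trace_mul_comm]
      simp only [transpose_mul, transpose_transpose, Matrix.mul_assoc]
    rw [this]
    exact ip_self_nonneg _
  have hb₁ := hRIP4.abs_sum_mul_sub_ip_le hδ (X := U * Vᵀ - Us * Vsᵀ) (Y := Z₁₂ + Z₂₁ᵀ) (by lia)
  have hb₂ := hRIP2.abs_sum_mul_le e hYrank
  have hy := fnorm_add_transpose_le Z₁₁ Z₁₂ Z₂₁ Z₂₂
  rw [← hZb] at hy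
  have hd := sqrt_two_mul_fnorm_le (U * Uᵀ - Us * Usᵀ) (U * Vᵀ - Us * Vsᵀ) (V * Vᵀ - Vs * Vsᵀ)
  rw [← hDb] at hd
  have hdy : fnorm (U * Vᵀ - Us * Vsᵀ) * fnorm (Z₁₂ + Z₂₁ᵀ) ≤ fnorm D * fnorm Z :=
    calc _ ≤ fnorm (U * Vᵀ - Us * Vsᵀ) * (√2 * fnorm Z) :=
          mul_le_mul_of_nonneg_left hy (fnorm_nonneg _)
      _ = √2 * fnorm (U * Vᵀ - Us * Vsᵀ) * fnorm Z := by ring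
      _ ≤ _ := mul_le_mul_of_nonneg_right hd hz0
  have hδdy := mul_le_mul_of_nonneg_left hdy hδ
  have hsy : 1 / 2 * (√(1 + δ2r) * fnorm (Z₁₂ + Z₂₁ᵀ)) ≤ √((1 + δ2r) / 2) * fnorm Z := by
    have hs : √((1 + δ2r) / 2) = 1 / 2 * (√(1 + δ2r) * √2) := by
      rw [Real.sqrt_div' _ zero_le_two, div_eq_iff (by positivity)]
      linear_combination (-1 / 2 * √(1 + δ2r)) * Real.mul_self_sqrt (zero_le_two (α := ℝ))
    rw [hs]
    have := mul_le_mul_of_nonneg_left hy (Real.sqrt_nonneg (1 + δ2r))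
    linarith
  have hesy := mul_le_mul_of_nonneg_left hsy hv0
  have hmain : 1 / 4 * fnorm Z * fnorm Z ≤
      (δ4r * fnorm D + √((1 + δ2r) / 2) * vnorm e) * fnorm Z := by
    have hp := mul_nonneg hδD.1 hz0
    linarith [(abs_le.1 hb₁).1, (abs_le.1 hb₂).1]
  exact le_of_mul_le_mul_right hmain hz
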